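/- arXiv:1207.0187 — 2 statements merged into one kernel-verified Lean document; each statement's English description precedes it below -/
import Mathlib

section
/- (Theorem 3.3, item 2) Suppose the random vectors P_1 and P_2 are independent (with arbitrary dependence among the coordinates of P_1), the follow-up vector P_2 is PRDS on {j : h_{2j} = 0}, and S is a valid selection rule which in addition only selects hypotheses with primary p-values at most a fixed threshold t, i.e. S(p) ⊆ {j : p_j ≤ t} for every p, where 0 < t < q_1 / (1 + ∑_{i=1}^{m−1} 1/i). Let q̃_1 = max{x > 0 : x(1 + ∑_{i=1}^{⌈tm/x − 1⌉} 1/i) = q_1}. Then Procedure 3.2 with parameters (q_1, q), modified by replacing q_1 with q̃_1 in the thresholds r q_1/m and R_2 q_1/m only, satisfies FDR ≤ q for the family of no-replicability nulls H_{NR,1},…,H_{NR,m}. -/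
open MeasureTheory ProbabilityTheory Finset

namespace Replicability

/-- A selection rule `S` is measurable: the preimage of each possible selected set is a
measurable subset of `[0,1]^m` (here all of `ℝ^m`). -/
def MeasRule (m : ℕ) (S : (Fin m → ℝ) → Finset (Fin m)) : Prop :=
  ∀ A : Finset (Fin m), MeasurableSet {p : Fin m → ℝ | S p = A}

/-- A valid selection rule: for any `p`, any `j ∈ S p`, and any `p'` agreeing with `p` in all
coordinates except possibly the `j`-th such that `j` is still selected under `p'`,
the selected set is unchanged. -/
def ValidRule (m : ℕ) (S : (Fin m → ℝ) → Finset (Fin m)) : Prop :=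
  ∀ p p' : Fin m → ℝ, ∀ j ∈ S p, (∀ i, i ≠ j → p' i = p i) → j ∈ S p' → S p' = S p

/-- Null p-values are superuniform: if `h j = false` (hypothesis `j` is a true null in this
study) then `Pr(P_j ≤ x) ≤ x` for all `x ∈ [0,1]`. -/
def Superuniform {Ω : Type*} [MeasurableSpace Ω] (μ : Measure Ω) {m : ℕ}
    (P : Ω → Fin m → ℝ) (h : Fin m → Bool) : Prop :=
  ∀ j : Fin m, h j = false → ∀ x : ℝ, 0 ≤ x → x ≤ 1 →
    μ {ω | P ω j ≤ x} ≤ ENNReal.ofReal x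

/-- p-values take values in `[0,1]`. -/
def InUnit {Ω : Type*} {m : ℕ} (P : Ω → Fin m → ℝ) : Prop :=
  ∀ ω j, P ω j ∈ Set.Icc (0 : ℝ) 1

/-- The (generalized) rejection set of Procedure 3.2: with selected set `𝓡₁ = S p₁` of size
`R₁`, primary thresholds `r * a / m` and follow-up thresholds `r * b R₁ / R₁`, let
`R₂ = max { r ≤ m : #{j ∈ 𝓡₁ : p₁ⱼ ≤ r a/m ∧ p₂ⱼ ≤ r (b R₁)/R₁} = r }`, and reject
`{j ∈ 𝓡₁ : p₁ⱼ ≤ R₂ a/m ∧ p₂ⱼ ≤ R₂ (b R₁)/R₁}`.  The basic Procedure 3.2 with parameters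
`(q₁, q)` is obtained with `a = q₁` and `b = fun _ => q - q₁`. -/
noncomputable def rejSet (m : ℕ) (S : (Fin m → ℝ) → Finset (Fin m))
    (a : ℝ) (b : ℕ → ℝ) (p1 p2 : Fin m → ℝ) : Finset (Fin m) :=
  let R1 := (S p1).card
  let R2 := sSup {r : ℕ | r ≤ m ∧
    ((S p1).filter
      (fun j => p1 j ≤ r * a / m ∧ p2 j ≤ r * b R1 / R1)).card = r}
  (S p1).filter (fun j => p1 j ≤ R2 * a / m ∧ p2 j ≤ R2 * b R1 / R1)

/-- False discovery proportion of rejection set `R` with respect to the set `I` of true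
nulls: `|R ∩ I| / max(|R|, 1)`. -/
noncomputable def FDP {m : ℕ} (I R : Finset (Fin m)) : ℝ :=
  ((R ∩ I).card : ℝ) / ((max R.card 1 : ℕ) : ℝ)

/-- The set `I_{ab} = {j : (h₁ⱼ, h₂ⱼ) = (a, b)}` (with `true` for 1, `false` for 0). -/
def Iset {m : ℕ} (h1 h2 : Fin m → Bool) (a b : Bool) : Finset (Fin m) :=
  Finset.univ.filter fun j => h1 j = a ∧ h2 j = b

/-- The indices of true no-replicability nulls: `I₀₀ ∪ I₀₁ ∪ I₁₀`. -/
def nullNR {m : ℕ} (h1 h2 : Fin m → Bool) : Finset (Fin m) :=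
  Finset.univ.filter fun j => h1 j = false ∨ h2 j = false

/-- Harmonic sum `∑_{i=1}^n 1/i`. -/
noncomputable def Hsum (n : ℕ) : ℝ := ∑ i ∈ Finset.range n, (1 : ℝ) / (i + 1)

/-- PRDS property of a random vector `Q` on a set `T` of coordinates: for every measurable
increasing set `D` and every `i ∈ T`, some monotone measurable `g` is a version of
`p ↦ Pr(Q ∈ D | Q_i = p)`. -/
def PRDS {Ω : Type*} [MeasurableSpace Ω] (μ : Measure Ω) {m : ℕ}
    (Q : Ω → Fin m → ℝ) (T : Set (Fin m)) : Prop :=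
  ∀ D : Set (Fin m → ℝ), MeasurableSet D →
    (∀ x ∈ D, ∀ y : Fin m → ℝ, x ≤ y → y ∈ D) →
    ∀ i ∈ T, ∃ g : ℝ → ℝ, Monotone g ∧ Measurable g ∧
      ∀ B : Set ℝ, MeasurableSet B →
        (μ ({ω | Q ω ∈ D} ∩ {ω | Q ω i ∈ B})).toReal =
          ∫ ω in {ω | Q ω i ∈ B}, g (Q ω i) ∂μ

end Replicability

namespace Replicability

/-- The largest `r ≤ m` with `#(T r) = r`. -/
noncomputable def stepUp (m : ℕ) (T : ℕ → Finset (Fin m)) : ℕ :=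
  sSup {r : ℕ | r ≤ m ∧ (T r).card = r}

/-- The candidates of Procedure 3.2 at level `r`. -/
noncomputable def candidates {m : ℕ} (S : (Fin m → ℝ) → Finset (Fin m)) (a b : ℝ)
    (p1 p2 : Fin m → ℝ) (r : ℕ) : Finset (Fin m) :=
  (S p1).filter fun j => p1 j ≤ r * a / m ∧ p2 j ≤ r * b / (S p1).card

/-- The contribution of hypothesis `j` to the false discovery proportion. -/
noncomputable def weight {m : ℕ} (R : Finset (Fin m)) (j : Fin m) : ℝ :=
  if j ∈ R then 1 / (R.card : ℝ) else 0

section Deterministic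

variable {m : ℕ}

lemma le_stepUp_iff {T : ℕ → Finset (Fin m)} (hT : Monotone T) (k : ℕ) :
    k ≤ stepUp m T ↔ ∃ r, k ≤ r ∧ r ≤ m ∧ r ≤ (T r).card := by
  have hcard : ∀ r, (T r).card ≤ m := fun r => by simpa using Finset.card_le_univ (T r)
  have hbdd : BddAbove {r : ℕ | r ≤ m ∧ (T r).card = r} := ⟨m, fun r hr => hr.1⟩
  have key : ∀ r, r ≤ m → r ≤ (T r).card → ∃ s, r ≤ s ∧ s ≤ m ∧ (T s).card = s := by
    intro r hr h
    induction hn : m - r generalizing r with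
    | zero => exact ⟨r, le_rfl, hr, by have := hcard r; omega⟩
    | succ n ih =>
      rcases h.eq_or_lt with h | h
      · exact ⟨r, le_rfl, hr, h.symm⟩
      · obtain ⟨s, h₁, h₂⟩ := ih (r + 1) (by omega)
          (h.trans_le (Finset.card_le_card (hT (Nat.le_succ r)))) (by omega)
        exact ⟨s, by omega, h₂⟩
  constructor
  · intro h
    have hne : {r : ℕ | r ≤ m ∧ (T r).card = r}.Nonempty := by
      obtain ⟨s, -, hs⟩ := key 0 (Nat.zero_le _) (Nat.zero_le _)
      exact ⟨s, hs⟩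
    have := Nat.sSup_mem hne hbdd
    exact ⟨stepUp m T, h, this.1, this.2.ge⟩
  · rintro ⟨r, hkr, hr, hc⟩
    obtain ⟨s, hrs, hs⟩ := key r hr hc
    exact (hkr.trans hrs).trans (le_csSup hbdd hs)

lemma stepUp_spec {T : ℕ → Finset (Fin m)} (hT : Monotone T) :
    stepUp m T ≤ m ∧ (T (stepUp m T)).card = stepUp m T := by
  have hcard : ∀ r, (T r).card ≤ m := fun r => by simpa using Finset.card_le_univ (T r)
  obtain ⟨r, h₁, h₂, h₃⟩ := (le_stepUp_iff hT _).1 le_rfl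
  have h₄ : r ≤ stepUp m T := (le_stepUp_iff hT _).2 ⟨r, le_rfl, h₂, h₃⟩
  obtain rfl : stepUp m T = r := le_antisymm h₁ h₄
  refine ⟨h₂, le_antisymm ?_ h₃⟩
  by_contra! hlt
  have : stepUp m T + 1 ≤ stepUp m T := (le_stepUp_iff hT _).2 ⟨_, le_rfl,
    hlt.trans_le (hcard _), Nat.succ_le_of_lt hlt |>.trans
      (Finset.card_le_card (hT (Nat.le_succ _)))⟩
  omega

lemma stepUp_mono {T T' : ℕ → Finset (Fin m)} (hT : Monotone T) (hT' : Monotone T')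
    (h : ∀ r, T r ⊆ T' r) : stepUp m T ≤ stepUp m T' := by
  obtain ⟨h₁, h₂⟩ := stepUp_spec hT
  exact (le_stepUp_iff hT' _).2 ⟨_, le_rfl, h₁, h₂.ge.trans (Finset.card_le_card (h _))⟩

lemma candidates_mono (S : (Fin m → ℝ) → Finset (Fin m)) {a b : ℝ} (ha : 0 ≤ a) (hb : 0 ≤ b)
    (p1 p2 : Fin m → ℝ) : Monotone (candidates S a b p1 p2) := by
  intro r s hrs j hj
  simp only [candidates, Finset.mem_filter] at hj ⊢
  have : (r : ℝ) ≤ s := by exact_mod_cast hrs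
  exact ⟨hj.1, hj.2.1.trans (by gcongr), hj.2.2.trans (by gcongr)⟩

lemma candidates_anti (S : (Fin m → ℝ) → Finset (Fin m)) (a b : ℝ) (p1 : Fin m → ℝ)
    {p2 p2' : Fin m → ℝ} (h : p2 ≤ p2') (r : ℕ) :
    candidates S a b p1 p2' r ⊆ candidates S a b p1 p2 r := by
  intro j hj
  simp only [candidates, Finset.mem_filter] at hj ⊢
  exact ⟨hj.1, hj.2.1, (h j).trans hj.2.2⟩

lemma rejSet_eq_candidates (S : (Fin m → ℝ) → Finset (Fin m)) (a b : ℝ) (p1 p2 : Fin m → ℝ) :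
    rejSet m S a (fun _ => b) p1 p2 =
      candidates S a b p1 p2 (stepUp m (candidates S a b p1 p2)) := rfl

lemma FDP_eq_sum_weight (I R : Finset (Fin m)) : FDP I R = ∑ j ∈ I, weight R j := by
  unfold FDP weight
  rw [← Finset.sum_filter, Finset.filter_mem_eq_inter, Finset.sum_const, nsmul_eq_mul,
    Finset.inter_comm]
  rcases R.eq_empty_or_nonempty with rfl | hR
  · simp
  · rw [max_eq_left (Finset.card_pos.2 hR)]
    ring

lemma weight_nonneg (R : Finset (Fin m)) (j : Fin m) : 0 ≤ weight R j := by
  unfold weight; split_ifs <;> positivity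

lemma weight_le_one (R : Finset (Fin m)) (j : Fin m) : weight R j ≤ 1 := by
  unfold weight
  split_ifs with h
  · have : (1 : ℝ) ≤ R.card := by exact_mod_cast Finset.card_pos.2 ⟨j, h⟩
    exact (div_le_one (by linarith)).2 this
  · exact zero_le_one

/-- Summation by parts of `1 / N`, truncated at `n`. -/
lemma one_div_le_sum_indicator {N : ℕ} (hN : 1 ≤ N) (n : ℕ) :
    (1 : ℝ) / N ≤ ∑ k ∈ Finset.range n,
      (1 / ((k : ℝ) + 1) - 1 / ((k : ℝ) + 2)) * (if N ≤ k + 1 then 1 else 0) + 1 / ((n : ℝ) + 1) := by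
  induction n with
  | zero =>
    have : (1 : ℝ) ≤ N := by exact_mod_cast hN
    simpa using inv_le_one_of_one_le₀ this
  | succ n ih =>
    rw [Finset.sum_range_succ]
    push_cast
    by_cases h : N ≤ n + 1
    · rw [if_pos h]
      have : ((n : ℝ) + 1 + 1) = n + 2 := by ring
      rw [this]
      linarith
    · rw [if_neg h]
      have h' : (n : ℝ) + 1 + 1 ≤ N := by exact_mod_cast (by omega : n + 1 + 1 ≤ N)
      have h₁ : (1 : ℝ) / N ≤ 1 / ((n : ℝ) + 1 + 1) := by gcongr
      have h₂ : 0 ≤ ∑ k ∈ Finset.range n,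
          (1 / ((k : ℝ) + 1) - 1 / ((k : ℝ) + 2)) * (if N ≤ k + 1 then (1 : ℝ) else 0) := by
        refine Finset.sum_nonneg fun k _ => mul_nonneg ?_ (by split_ifs <;> norm_num)
        rw [sub_nonneg]
        gcongr
        norm_num
      linarith

end Deterministic

section Measurability

variable {m : ℕ}

lemma measurableSet_mem_rule {S : (Fin m → ℝ) → Finset (Fin m)} (hS : MeasRule m S) (j : Fin m) :
    MeasurableSet {p : Fin m → ℝ | j ∈ S p} := by
  have : {p : Fin m → ℝ | j ∈ S p} = ⋃ A ∈ {A : Finset (Fin m) | j ∈ A}, {p | S p = A} := by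
    ext p; simp
  rw [this]
  exact MeasurableSet.biUnion (Set.to_countable _) fun A _ => hS A

lemma measurable_card_rule {S : (Fin m → ℝ) → Finset (Fin m)} (hS : MeasRule m S) :
    Measurable fun p => (S p).card := by
  have : (fun p => (S p).card) = fun p => ∑ j, if j ∈ S p then 1 else 0 := by
    ext p; simp
  rw [this]
  exact Finset.measurable_sum _ fun j _ =>
    Measurable.ite (measurableSet_mem_rule hS j) measurable_const measurable_const

lemma measurableSet_mem_candidates {S : (Fin m → ℝ) → Finset (Fin m)} (hS : MeasRule m S)
    (a b : ℝ) (j : Fin m) {N : (Fin m → ℝ) × (Fin m → ℝ) → ℕ} (hN : Measurable N) :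
    MeasurableSet {x : (Fin m → ℝ) × (Fin m → ℝ) | j ∈ candidates S a b x.1 x.2 (N x)} := by
  have hN' : Measurable fun x => (N x : ℝ) := measurable_from_top.comp hN
  have hc : Measurable fun x : (Fin m → ℝ) × (Fin m → ℝ) => ((S x.1).card : ℝ) :=
    (measurable_from_top (f := fun n : ℕ => (n : ℝ))).comp
      ((measurable_card_rule hS).comp measurable_fst)
  have h₁ : Measurable fun x : (Fin m → ℝ) × (Fin m → ℝ) => x.1 j :=
    (measurable_pi_apply j).comp measurable_fst
  have h₂ : Measurable fun x : (Fin m → ℝ) × (Fin m → ℝ) => x.2 j :=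
    (measurable_pi_apply j).comp measurable_snd
  have : {x : (Fin m → ℝ) × (Fin m → ℝ) | j ∈ candidates S a b x.1 x.2 (N x)} =
      Prod.fst ⁻¹' {p | j ∈ S p} ∩ ({x | x.1 j ≤ N x * a / m} ∩
        {x | x.2 j ≤ N x * b / (S x.1).card}) := by
    ext x
    simp [candidates]
  rw [this]
  exact (measurable_fst (measurableSet_mem_rule hS j)).inter
    ((measurableSet_le h₁ ((hN'.mul_const a).div_const _)).inter
      (measurableSet_le h₂ ((hN'.mul_const b).div hc)))

lemma measurable_card_candidates {S : (Fin m → ℝ) → Finset (Fin m)} (hS : MeasRule m S)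
    (a b : ℝ) {N : (Fin m → ℝ) × (Fin m → ℝ) → ℕ} (hN : Measurable N) :
    Measurable fun x : (Fin m → ℝ) × (Fin m → ℝ) => (candidates S a b x.1 x.2 (N x)).card := by
  have : (fun x : (Fin m → ℝ) × (Fin m → ℝ) => (candidates S a b x.1 x.2 (N x)).card) =
      fun x => ∑ j, if j ∈ candidates S a b x.1 x.2 (N x) then 1 else 0 := by
    ext x; simp
  rw [this]
  exact Finset.measurable_sum _ fun j _ =>
    Measurable.ite (measurableSet_mem_candidates hS a b j hN) measurable_const measurable_const

lemma measurable_stepUp {S : (Fin m → ℝ) → Finset (Fin m)} (hS : MeasRule m S)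
    {a b : ℝ} (ha : 0 ≤ a) (hb : 0 ≤ b) :
    Measurable fun x : (Fin m → ℝ) × (Fin m → ℝ) => stepUp m (candidates S a b x.1 x.2) := by
  refine measurable_of_Ici fun k => ?_
  have : (fun x : (Fin m → ℝ) × (Fin m → ℝ) => stepUp m (candidates S a b x.1 x.2)) ⁻¹' Set.Ici k =
      ⋃ r ∈ {r : ℕ | k ≤ r ∧ r ≤ m}, {x | r ≤ (candidates S a b x.1 x.2 r).card} := by
    ext x
    simp [le_stepUp_iff (candidates_mono S ha hb x.1 x.2), and_assoc]
  rw [this]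
  exact MeasurableSet.biUnion (Set.to_countable _) fun r _ =>
    measurableSet_le measurable_const (measurable_card_candidates hS a b measurable_const)

lemma measurable_weight_rejSet {S : (Fin m → ℝ) → Finset (Fin m)} (hS : MeasRule m S)
    {a b : ℝ} (ha : 0 ≤ a) (hb : 0 ≤ b) (j : Fin m) :
    Measurable fun x : (Fin m → ℝ) × (Fin m → ℝ) =>
      weight (rejSet m S a (fun _ => b) x.1 x.2) j := by
  simp only [weight, rejSet_eq_candidates]
  have hN := measurable_stepUp hS ha hb
  refine Measurable.ite (measurableSet_mem_candidates hS a b j hN) ?_ measurable_const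
  exact (measurable_from_top (f := fun n : ℕ => 1 / (n : ℝ))).comp
    (measurable_card_candidates hS a b hN)

end Measurability

section Probability

variable {Ω : Type*} [MeasurableSpace Ω] {μ : Measure Ω} [IsProbabilityMeasure μ] {m : ℕ}

lemma Superuniform.measureReal_le {P : Ω → Fin m → ℝ} {h : Fin m → Bool}
    (hP : Superuniform μ P h) {j : Fin m} (hj : h j = false) {x : ℝ} (hx : 0 ≤ x) :
    μ.real {ω | P ω j ≤ x} ≤ x := by
  by_cases hx1 : x ≤ 1
  · exact ENNReal.toReal_le_of_le_ofReal hx (hP j hj x hx hx1)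
  · exact measureReal_le_one.trans (not_le.1 hx1).le

/-- If `1 / N` is charged only on `{X ≤ t, X ≤ N c}` with `X` superuniform, its expectation is at
most `c` times a harmonic sum, whatever the dependence of `N` and `X`. -/
lemma integral_le_mul_Hsum {X : Ω → ℝ} (hX : Measurable X)
    (hsup : ∀ x, 0 ≤ x → μ.real {ω | X ω ≤ x} ≤ x) {c t : ℝ} (hc : 0 ≤ c) (ht : 0 ≤ t) {n : ℕ}
    (htn : t ≤ (n + 1) * c) {W : Ω → ℝ} (hW0 : ∀ ω, 0 ≤ W ω)
    (hW : ∀ ω, W ω ≠ 0 → ∃ N : ℕ, 1 ≤ N ∧ W ω = 1 / N ∧ X ω ≤ t ∧ X ω ≤ N * c) :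
    ∫ ω, W ω ∂μ ≤ c * (1 + Hsum n) := by
  set d : ℕ → ℝ := fun k => 1 / ((k : ℝ) + 1) - 1 / ((k : ℝ) + 2) with hd
  have hd0 : ∀ k, 0 ≤ d k := fun k => by
    simp only [hd]
    rw [sub_nonneg]
    gcongr
    norm_num
  have hmeas : ∀ x : ℝ, MeasurableSet {ω | X ω ≤ x} := fun x => measurableSet_le hX measurable_const
  have hint : ∀ x : ℝ, Integrable ({ω | X ω ≤ x}.indicator (1 : Ω → ℝ)) μ := fun x =>
    (integrable_const (1 : ℝ)).indicator (hmeas x)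
  have hind : ∀ x : ℝ, ∫ ω, {ω | X ω ≤ x}.indicator (1 : Ω → ℝ) ω ∂μ = μ.real {ω | X ω ≤ x} :=
    fun x => integral_indicator_one (hmeas x)
  have hI1 : Integrable (fun ω => ∑ k ∈ Finset.range n,
      d k * {ω | X ω ≤ ((k : ℝ) + 1) * c}.indicator (1 : Ω → ℝ) ω) μ :=
    integrable_finsetSum _ fun k _ => (hint _).const_mul _
  have hI2 : Integrable (fun ω => 1 / ((n : ℝ) + 1) *
      {ω | X ω ≤ t}.indicator (1 : Ω → ℝ) ω) μ := (hint _).const_mul _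
  have hpt : ∀ ω, W ω ≤ ∑ k ∈ Finset.range n,
      d k * {ω | X ω ≤ ((k : ℝ) + 1) * c}.indicator (1 : Ω → ℝ) ω +
      1 / ((n : ℝ) + 1) * {ω | X ω ≤ t}.indicator (1 : Ω → ℝ) ω := by
    intro ω
    have hnn : ∀ s : Set Ω, 0 ≤ s.indicator (1 : Ω → ℝ) ω := fun s =>
      Set.indicator_nonneg (fun _ _ => zero_le_one) ω
    by_cases hω : W ω = 0
    · rw [hω]
      exact add_nonneg (Finset.sum_nonneg fun k _ => mul_nonneg (hd0 k) (hnn _))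
        (mul_nonneg (by positivity) (hnn _))
    · obtain ⟨N, hN, hWN, hXt, hXN⟩ := hW ω hω
      rw [hWN]
      refine (one_div_le_sum_indicator hN n).trans (add_le_add (Finset.sum_le_sum fun k _ =>
        mul_le_mul_of_nonneg_left ?_ (hd0 k)) ?_)
      · split_ifs with hk
        · have hk' : (N : ℝ) ≤ k + 1 := by exact_mod_cast hk
          have : X ω ≤ ((k : ℝ) + 1) * c := hXN.trans (by gcongr)
          rw [Set.indicator_of_mem (by exact this)]
          rfl
        · exact hnn _
      · rw [Set.indicator_of_mem (by exact hXt)]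
        simp
  calc ∫ ω, W ω ∂μ
      ≤ ∫ ω, (∑ k ∈ Finset.range n,
          d k * {ω | X ω ≤ ((k : ℝ) + 1) * c}.indicator (1 : Ω → ℝ) ω +
          1 / ((n : ℝ) + 1) * {ω | X ω ≤ t}.indicator (1 : Ω → ℝ) ω) ∂μ :=
        integral_mono_of_nonneg (.of_forall hW0) (hI1.add hI2) (.of_forall hpt)
    _ = ∑ k ∈ Finset.range n, d k * μ.real {ω | X ω ≤ ((k : ℝ) + 1) * c} +
          1 / ((n : ℝ) + 1) * μ.real {ω | X ω ≤ t} := by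
        rw [integral_add hI1 hI2, integral_finsetSum _ fun k _ => (hint _).const_mul _]
        simp only [integral_const_mul, hind]
    _ ≤ ∑ k ∈ Finset.range n, c * (1 / ((k : ℝ) + 1)) + c := by
        refine add_le_add (Finset.sum_le_sum fun k _ => ?_) ?_
        · calc d k * μ.real {ω | X ω ≤ ((k : ℝ) + 1) * c}
              ≤ d k * (((k : ℝ) + 1) * c) := by
                gcongr
                · exact hd0 k
                · exact hsup _ (by positivity)
            _ = c * (1 / ((k : ℝ) + 2)) := by
                simp only [hd]
                field_simp
                ring
            _ ≤ c * (1 / ((k : ℝ) + 1)) := by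
                gcongr
                norm_num
        · calc 1 / ((n : ℝ) + 1) * μ.real {ω | X ω ≤ t}
              ≤ 1 / ((n : ℝ) + 1) * ((n + 1) * c) := by
                gcongr
                exact (hsup t ht).trans htn
            _ = c := by field_simp
    _ = c * (1 + Hsum n) := by
        rw [← Finset.mul_sum, Hsum]
        ring

/-- Under PRDS, `u ↦ Pr(Q ∈ D | Q_i ≤ u)` is nondecreasing (in cross-multiplied form). -/
lemma PRDS.mul_le_mul {Q : Ω → Fin m → ℝ} (hQ : Measurable Q) (hQu : InUnit Q) {T : Set (Fin m)}
    (hT : PRDS μ Q T) {D : Set (Fin m → ℝ)} (hD : MeasurableSet D)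
    (hDup : ∀ x ∈ D, ∀ y : Fin m → ℝ, x ≤ y → y ∈ D) {i : Fin m} (hi : i ∈ T) {u v : ℝ}
    (huv : u ≤ v) :
    μ.real ({ω | Q ω ∈ D} ∩ {ω | Q ω i ≤ u}) * μ.real {ω | Q ω i ≤ v} ≤
      μ.real ({ω | Q ω ∈ D} ∩ {ω | Q ω i ≤ v}) * μ.real {ω | Q ω i ≤ u} := by
  obtain ⟨g, hg, hgm, hgD⟩ := hT D hD hDup i hi
  have hQi : Measurable fun ω => Q ω i := (measurable_pi_apply i).comp hQ
  have hgint : Integrable (fun ω => g (Q ω i)) μ := by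
    refine Integrable.of_mem_Icc (g 0) (g 1) (hgm.comp hQi).aemeasurable (.of_forall fun ω => ?_)
    exact ⟨hg (hQu ω i).1, hg (hQu ω i).2⟩
  have hmu : MeasurableSet {ω | Q ω i ≤ u} := hQi measurableSet_Iic
  have hmuv : MeasurableSet {ω | Q ω i ∈ Set.Ioc u v} := hQi measurableSet_Ioc
  have hsplit : {ω | Q ω i ≤ v} = {ω | Q ω i ≤ u} ∪ {ω | Q ω i ∈ Set.Ioc u v} := by
    ext ω
    simp only [Set.mem_ofPred_eq, Set.mem_union, Set.mem_Ioc]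
    constructor
    · intro h
      by_cases h' : Q ω i ≤ u
      · exact .inl h'
      · exact .inr ⟨not_le.1 h', h⟩
    · rintro (h | h)
      · exact h.trans huv
      · exact h.2
  have hdisj : Disjoint {ω | Q ω i ≤ u} {ω | Q ω i ∈ Set.Ioc u v} :=
    Set.disjoint_left.2 fun ω h h' => not_lt.2 h h'.1
  have hv : μ.real {ω | Q ω i ≤ v} =
      μ.real {ω | Q ω i ≤ u} + μ.real {ω | Q ω i ∈ Set.Ioc u v} := by
    rw [hsplit, measureReal_union hdisj hmuv]
  have hQD : MeasurableSet {ω | Q ω ∈ D} := hQ hD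
  have hDv : μ.real ({ω | Q ω ∈ D} ∩ {ω | Q ω i ≤ v}) =
      μ.real ({ω | Q ω ∈ D} ∩ {ω | Q ω i ≤ u}) +
        μ.real ({ω | Q ω ∈ D} ∩ {ω | Q ω i ∈ Set.Ioc u v}) := by
    rw [hsplit, Set.inter_union_distrib_left,
      measureReal_union (hdisj.mono Set.inter_subset_right Set.inter_subset_right)
        (hQD.inter hmuv)]
  have h₁ : μ.real ({ω | Q ω ∈ D} ∩ {ω | Q ω i ≤ u}) ≤ g u * μ.real {ω | Q ω i ≤ u} := by
    have := hgD (Set.Iic u) measurableSet_Iic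
    calc _ = ∫ ω in {ω | Q ω i ≤ u}, g (Q ω i) ∂μ := this
      _ ≤ ∫ _ω in {ω | Q ω i ≤ u}, g u ∂μ :=
        setIntegral_mono_on hgint.integrableOn (integrable_const _) hmu fun ω hω => hg hω
      _ = _ := by rw [setIntegral_const, smul_eq_mul, mul_comm]
  have h₂ : g u * μ.real {ω | Q ω i ∈ Set.Ioc u v} ≤
      μ.real ({ω | Q ω ∈ D} ∩ {ω | Q ω i ∈ Set.Ioc u v}) := by
    have := hgD (Set.Ioc u v) measurableSet_Ioc
    calc _ = ∫ _ω in {ω | Q ω i ∈ Set.Ioc u v}, g u ∂μ := by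
          rw [setIntegral_const, smul_eq_mul, mul_comm]
      _ ≤ ∫ ω in {ω | Q ω i ∈ Set.Ioc u v}, g (Q ω i) ∂μ :=
        setIntegral_mono_on (integrable_const _) hgint.integrableOn hmuv fun ω hω => hg hω.1.le
      _ = _ := this.symm
  rw [hv, hDv]
  have h₃ := mul_le_mul_of_nonneg_right h₁ (measureReal_nonneg (μ := μ)
    (s := {ω | Q ω i ∈ Set.Ioc u v}))
  have h₄ := mul_le_mul_of_nonneg_right h₂ (measureReal_nonneg (μ := μ)
    (s := {ω | Q ω i ≤ u}))
  linarith

/-- The Benjamini–Yekutieli bound for a nonincreasing number of rejections `N`. -/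
lemma PRDS.sum_measureReal_le {Q : Ω → Fin m → ℝ} (hQ : Measurable Q) (hQu : InUnit Q)
    {T : Set (Fin m)} (hT : PRDS μ Q T) {i : Fin m} (hi : i ∈ T) {β : ℝ} (hβ : 0 ≤ β)
    (hsup : ∀ x, 0 ≤ x → μ.real {ω | Q ω i ≤ x} ≤ x)
    {N : (Fin m → ℝ) → ℕ} (hN : Measurable N) (hanti : Antitone N) (n : ℕ) :
    ∑ k ∈ Finset.range n, 1 / ((k : ℝ) + 1) *
      μ.real ({ω | Q ω i ≤ ((k : ℝ) + 1) * β} ∩ {ω | N (Q ω) = k + 1}) ≤ β := by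
  have hQi : Measurable fun ω => Q ω i := (measurable_pi_apply i).comp hQ
  set F : ℕ → ℝ := fun k => μ.real {ω | Q ω i ≤ k * β} with hF
  set G : ℕ → ℕ → ℝ := fun l k => μ.real ({ω | N (Q ω) ≤ l} ∩ {ω | Q ω i ≤ k * β}) with hG
  have hF0 : ∀ k, 0 ≤ F k := fun k => measureReal_nonneg
  have hG0 : ∀ l k, 0 ≤ G l k := fun l k => measureReal_nonneg
  have hGF : ∀ l k, G l k ≤ F k := fun l k => measureReal_mono Set.inter_subset_right
  have hmono : ∀ k, F k ≤ F (k + 1) := fun k => by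
    refine measureReal_mono fun ω hω => ?_
    simp only [Set.mem_ofPred_eq] at hω ⊢
    push_cast
    nlinarith
  have hterm : ∀ k : ℕ,
      μ.real ({ω | Q ω i ≤ ((k : ℝ) + 1) * β} ∩ {ω | N (Q ω) = k + 1}) =
        G (k + 1) (k + 1) - G k (k + 1) := by
    intro k
    have hu : {ω | N (Q ω) ≤ k + 1} ∩ {ω | Q ω i ≤ ((k + 1 : ℕ) : ℝ) * β} =
        ({ω | N (Q ω) ≤ k} ∩ {ω | Q ω i ≤ ((k + 1 : ℕ) : ℝ) * β}) ∪
          ({ω | Q ω i ≤ ((k : ℝ) + 1) * β} ∩ {ω | N (Q ω) = k + 1}) := by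
      ext ω
      simp only [Set.mem_inter_iff, Set.mem_ofPred_eq, Set.mem_union, Nat.cast_add, Nat.cast_one]
      rw [Nat.le_succ_iff]
      tauto
    simp only [hG]
    rw [hu, measureReal_union]
    · ring
    · refine Set.disjoint_left.2 fun ω h h' => ?_
      have h₁ : N (Q ω) ≤ k := h.1
      have h₂ : N (Q ω) = k + 1 := h'.2
      omega
    · exact (hQi measurableSet_Iic).inter ((hN.comp hQ) (measurableSet_singleton (k + 1)))
  have hprds : ∀ k, G k k * F (k + 1) ≤ G k (k + 1) * F k := by
    intro k
    refine hT.mul_le_mul hQ hQu (D := {p | N p ≤ k}) (hN measurableSet_Iic)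
      (fun x hx y hxy => (hanti hxy).trans hx) hi ?_
    push_cast
    nlinarith
  have hstep : ∀ k : ℕ, 1 / ((k : ℝ) + 1) * (G (k + 1) (k + 1) - G k (k + 1)) ≤
      β * (G (k + 1) (k + 1) / F (k + 1)) - β * (G k k / F k) := by
    intro k
    rcases (hF0 (k + 1)).eq_or_lt with h | h
    · have hk : F k = 0 := le_antisymm (h ▸ hmono k) (hF0 k)
      have h₁ : G (k + 1) (k + 1) = 0 := le_antisymm (h ▸ hGF _ _) (hG0 _ _)
      have h₂ : G k (k + 1) = 0 := le_antisymm (h ▸ hGF _ _) (hG0 _ _)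
      simp [hk, h₁, h₂]
    · have hFle : F (k + 1) ≤ ((k : ℝ) + 1) * β := by
        have := hsup (((k + 1 : ℕ) : ℝ) * β) (by positivity)
        simpa [hF] using this
      have hdiff : 0 ≤ G (k + 1) (k + 1) - G k (k + 1) := hterm k ▸ measureReal_nonneg
      have hratio : G k k / F k ≤ G k (k + 1) / F (k + 1) := by
        rcases (hF0 k).eq_or_lt with h' | h'
        · rw [← h', div_zero]
          exact div_nonneg (hG0 _ _) h.le
        · exact (div_le_div_iff₀ h' h).2 (hprds k)
      calc 1 / ((k : ℝ) + 1) * (G (k + 1) (k + 1) - G k (k + 1))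
          = (1 / ((k : ℝ) + 1) * F (k + 1)) *
              ((G (k + 1) (k + 1) - G k (k + 1)) / F (k + 1)) := by field_simp
        _ ≤ β * ((G (k + 1) (k + 1) - G k (k + 1)) / F (k + 1)) := by
            gcongr
            rw [one_div, inv_mul_le_iff₀ (by positivity)]
            exact hFle
        _ = β * (G (k + 1) (k + 1) / F (k + 1)) - β * (G k (k + 1) / F (k + 1)) := by ring
        _ ≤ _ := by gcongr
  calc _ ≤ ∑ k ∈ Finset.range n,
        (β * (G (k + 1) (k + 1) / F (k + 1)) - β * (G k k / F k)) :=
        Finset.sum_le_sum fun k _ => by rw [hterm]; exact hstep k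
    _ = β * (G n n / F n) - β * (G 0 0 / F 0) :=
        Finset.sum_range_sub (fun k => β * (G k k / F k)) n
    _ ≤ β * (G n n / F n) := sub_le_self _ (mul_nonneg hβ (div_nonneg (hG0 _ _) (hF0 _)))
    _ ≤ β * 1 := by
        gcongr
        exact div_le_one_of_le₀ (hGF _ _) (hF0 _)
    _ = β := mul_one β

/-- Contribution of a follow-up null, with the primary p-values held fixed. -/
lemma integral_weight_followup_le {P2 : Ω → Fin m → ℝ} (hP2 : Measurable P2) (hP2u : InUnit P2)
    {h2 : Fin m → Bool} (hsup2 : Superuniform μ P2 h2) (hPRDS : PRDS μ P2 {j | h2 j = false})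
    {S : (Fin m → ℝ) → Finset (Fin m)} (hS : MeasRule m S) {a b : ℝ} (ha : 0 ≤ a) (hb : 0 ≤ b)
    {j : Fin m} (hj : h2 j = false) (p1 : Fin m → ℝ) :
    ∫ ω, weight (rejSet m S a (fun _ => b) p1 (P2 ω)) j ∂μ ≤ b * weight (S p1) j := by
  by_cases hjS : j ∈ S p1
  swap
  · have : ∀ p2, weight (rejSet m S a (fun _ => b) p1 p2) j = 0 := fun p2 =>
      if_neg fun h => hjS (Finset.mem_filter.1 h).1
    simp only [this, integral_zero]
    exact mul_nonneg hb (weight_nonneg _ _)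
  set β : ℝ := b / (S p1).card with hβ
  have hw : b * weight (S p1) j = β := by rw [weight, if_pos hjS, hβ]; ring
  rw [hw]
  have hβ0 : 0 ≤ β := by positivity
  set N : (Fin m → ℝ) → ℕ := fun p2 => stepUp m (candidates S a b p1 p2) with hNdef
  have hN : Measurable N := (measurable_stepUp hS ha hb).comp measurable_prodMk_left
  have hanti : Antitone N := fun p p' hpp => stepUp_mono (candidates_mono S ha hb _ _)
    (candidates_mono S ha hb _ _) fun r => candidates_anti S a b p1 hpp r
  have hQi : Measurable fun ω => P2 ω j := (measurable_pi_apply j).comp hP2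
  have hE : ∀ k : ℕ, MeasurableSet ({ω | P2 ω j ≤ ((k : ℝ) + 1) * β} ∩ {ω | N (P2 ω) = k + 1}) :=
    fun k => (hQi measurableSet_Iic).inter ((hN.comp hP2) (measurableSet_singleton (k + 1)))
  have hint : ∀ k : ℕ, Integrable (fun ω => 1 / ((k : ℝ) + 1) *
      ({ω | P2 ω j ≤ ((k : ℝ) + 1) * β} ∩ {ω | N (P2 ω) = k + 1}).indicator (1 : Ω → ℝ) ω) μ :=
    fun k => ((integrable_const (1 : ℝ)).indicator (hE k)).const_mul _
  have hpt : ∀ ω, weight (rejSet m S a (fun _ => b) p1 (P2 ω)) j ≤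
      ∑ k ∈ Finset.range m, 1 / ((k : ℝ) + 1) *
        ({ω | P2 ω j ≤ ((k : ℝ) + 1) * β} ∩ {ω | N (P2 ω) = k + 1}).indicator (1 : Ω → ℝ) ω := by
    intro ω
    have hnn : ∀ k ∈ Finset.range m, 0 ≤ 1 / ((k : ℝ) + 1) *
        ({ω | P2 ω j ≤ ((k : ℝ) + 1) * β} ∩ {ω | N (P2 ω) = k + 1}).indicator (1 : Ω → ℝ) ω :=
      fun k _ => mul_nonneg (by positivity) (Set.indicator_nonneg (fun _ _ => zero_le_one) ω)
    rw [rejSet_eq_candidates, weight]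
    split_ifs with hmem
    · obtain ⟨hle, hcard⟩ := stepUp_spec (candidates_mono S ha hb p1 (P2 ω))
      have hpos := Finset.card_pos.2 ⟨j, hmem⟩
      rw [hcard] at hpos ⊢
      obtain ⟨k, hk⟩ := Nat.exists_eq_succ_of_ne_zero hpos.ne'
      have hω : ω ∈ {ω | P2 ω j ≤ ((k : ℝ) + 1) * β} ∩ {ω | N (P2 ω) = k + 1} := by
        refine ⟨?_, hk⟩
        have := (Finset.mem_filter.1 hmem).2.2
        rw [hk] at this
        simp only [Set.mem_ofPred_eq, hβ]
        rw [← mul_div_assoc]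
        exact_mod_cast this
      refine le_trans (le_of_eq ?_) (Finset.single_le_sum hnn (Finset.mem_range.2
        (by omega : k < m)))
      rw [Set.indicator_of_mem hω, hk]
      simp
    · exact Finset.sum_nonneg hnn
  calc _ ≤ ∫ ω, ∑ k ∈ Finset.range m, 1 / ((k : ℝ) + 1) *
        ({ω | P2 ω j ≤ ((k : ℝ) + 1) * β} ∩ {ω | N (P2 ω) = k + 1}).indicator (1 : Ω → ℝ) ω ∂μ :=
        integral_mono_of_nonneg (.of_forall fun ω => weight_nonneg _ _)
          (integrable_finsetSum _ fun k _ => hint k) (.of_forall hpt)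
    _ = ∑ k ∈ Finset.range m, 1 / ((k : ℝ) + 1) *
        μ.real ({ω | P2 ω j ≤ ((k : ℝ) + 1) * β} ∩ {ω | N (P2 ω) = k + 1}) := by
        rw [integral_finsetSum _ fun k _ => hint k]
        refine Finset.sum_congr rfl fun k _ => ?_
        rw [integral_const_mul, integral_indicator_one (hE k)]
    _ ≤ β := hPRDS.sum_measureReal_le hP2 hP2u hj hβ0
        (fun x hx => hsup2.measureReal_le hj hx) hN hanti m

lemma measurable_weight_rule {S : (Fin m → ℝ) → Finset (Fin m)} (hS : MeasRule m S) (j : Fin m) :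
    Measurable fun p => weight (S p) j :=
  Measurable.ite (measurableSet_mem_rule hS j)
    ((measurable_from_top (f := fun n : ℕ => 1 / (n : ℝ))).comp (measurable_card_rule hS))
    measurable_const

lemma integrable_weight {α : Type*} [MeasurableSpace α] {ν : Measure α} [IsFiniteMeasure ν]
    {R : α → Finset (Fin m)} {j : Fin m} (hR : Measurable fun x => weight (R x) j) :
    Integrable (fun x => weight (R x) j) ν :=
  Integrable.of_mem_Icc 0 1 hR.aemeasurable
    (.of_forall fun x => ⟨weight_nonneg (R x) j, weight_le_one (R x) j⟩)

/-- Contribution of a follow-up null. -/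
lemma integral_weight_le_of_indepFun {P1 P2 : Ω → Fin m → ℝ} (hP1 : Measurable P1)
    (hP2 : Measurable P2) (hP2u : InUnit P2) (hIndep : IndepFun P1 P2 μ)
    {h2 : Fin m → Bool} (hsup2 : Superuniform μ P2 h2) (hPRDS : PRDS μ P2 {j | h2 j = false})
    {S : (Fin m → ℝ) → Finset (Fin m)} (hS : MeasRule m S) {a b : ℝ} (ha : 0 ≤ a) (hb : 0 ≤ b)
    {j : Fin m} (hj : h2 j = false) :
    ∫ ω, weight (rejSet m S a (fun _ => b) (P1 ω) (P2 ω)) j ∂μ ≤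
      ∫ ω, b * weight (S (P1 ω)) j ∂μ := by
  have hprob1 : IsProbabilityMeasure (μ.map P1) := Measure.isProbabilityMeasure_map hP1.aemeasurable
  have hprob2 : IsProbabilityMeasure (μ.map P2) := Measure.isProbabilityMeasure_map hP2.aemeasurable
  have hw := measurable_weight_rejSet hS ha hb j
  have hwint : Integrable (fun x : (Fin m → ℝ) × (Fin m → ℝ) =>
      weight (rejSet m S a (fun _ => b) x.1 x.2) j) ((μ.map P1).prod (μ.map P2)) :=
    integrable_weight hw
  have hSw := measurable_weight_rule hS j
  calc ∫ ω, weight (rejSet m S a (fun _ => b) (P1 ω) (P2 ω)) j ∂μ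
      = ∫ x, weight (rejSet m S a (fun _ => b) x.1 x.2) j ∂(μ.map fun ω => (P1 ω, P2 ω)) :=
        (integral_map (hP1.prodMk hP2).aemeasurable hw.aestronglyMeasurable).symm
    _ = ∫ p1, ∫ p2, weight (rejSet m S a (fun _ => b) p1 p2) j ∂(μ.map P2) ∂(μ.map P1) := by
        rw [(indepFun_iff_map_prod_eq_prod_map_map hP1.aemeasurable hP2.aemeasurable).1 hIndep,
          integral_prod _ hwint]
    _ ≤ ∫ p1, b * weight (S p1) j ∂(μ.map P1) := by
        refine integral_mono hwint.integral_prod_left ((integrable_weight hSw).const_mul b)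
          fun p1 => ?_
        have hm1 : Measurable fun p2 => weight (rejSet m S a (fun _ => b) p1 p2) j :=
          hw.comp measurable_prodMk_left
        calc _ = ∫ ω, weight (rejSet m S a (fun _ => b) p1 (P2 ω)) j ∂μ :=
              integral_map hP2.aemeasurable hm1.aestronglyMeasurable
          _ ≤ _ := integral_weight_followup_le hP2 hP2u hsup2 hPRDS hS ha hb hj p1
    _ = ∫ ω, b * weight (S (P1 ω)) j ∂μ :=
        integral_map hP1.aemeasurable (hSw.const_mul b).aestronglyMeasurable

/-- Contribution of a primary null. -/
lemma integral_weight_primary_le {P1 P2 : Ω → Fin m → ℝ} (hP1 : Measurable P1)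
    {h1 : Fin m → Bool} (hsup1 : Superuniform μ P1 h1) {S : (Fin m → ℝ) → Finset (Fin m)}
    {t : ℝ} (ht : 0 ≤ t) (hSelThr : ∀ p : Fin m → ℝ, ∀ j ∈ S p, p j ≤ t)
    {a b : ℝ} (ha : 0 ≤ a) (hb : 0 ≤ b) {n : ℕ} (htn : t ≤ (n + 1) * (a / m))
    {j : Fin m} (hj : h1 j = false) :
    ∫ ω, weight (rejSet m S a (fun _ => b) (P1 ω) (P2 ω)) j ∂μ ≤ a / m * (1 + Hsum n) := by
  refine integral_le_mul_Hsum (X := fun ω => P1 ω j) ((measurable_pi_apply j).comp hP1)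
    (fun x hx => hsup1.measureReal_le hj hx) (by positivity) ht htn
    (fun ω => weight_nonneg _ _) fun ω hω => ?_
  rw [rejSet_eq_candidates] at hω ⊢
  have hmem : j ∈ candidates S a b (P1 ω) (P2 ω)
      (stepUp m (candidates S a b (P1 ω) (P2 ω))) := by
    by_contra h
    exact hω (if_neg h)
  obtain ⟨-, hcard⟩ := stepUp_spec (candidates_mono S ha hb (P1 ω) (P2 ω))
  have hpos := Finset.card_pos.2 ⟨j, hmem⟩
  rw [hcard] at hpos
  obtain ⟨hS, hle, -⟩ := Finset.mem_filter.1 hmem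
  refine ⟨_, hpos, ?_, hSelThr _ _ hS, by rw [← mul_div_assoc]; exact hle⟩
  rw [weight, if_pos hmem, hcard]

lemma sum_weight_le_one (R I : Finset (Fin m)) : ∑ j ∈ I, weight R j ≤ 1 := by
  rw [← FDP_eq_sum_weight, FDP]
  refine div_le_one_of_le₀ ?_ (Nat.cast_nonneg _)
  exact_mod_cast (Finset.card_le_card Finset.inter_subset_left).trans (le_max_left _ _)

end Probability

/-- Theorem 3.3, item 2: with arbitrary dependence within the primary study,
PRDS follow-up p-values independent of the primary study, and a valid selection rule selecting
only hypotheses with primary p-values at most `t < q₁/(1 + ∑_{i=1}^{m-1} 1/i)`, Procedure 3.2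
with the primary thresholds computed from
`q̃₁ = max{x > 0 : x (1 + ∑_{i=1}^{⌈tm/x - 1⌉} 1/i) = q₁}` controls the FDR at level `q`. -/
theorem procedure32_modified_FDR_control_thresholded_selection {Ω : Type*} [MeasurableSpace Ω]
    (μ : Measure Ω) [IsProbabilityMeasure μ]
    (m : ℕ) (hm : 1 ≤ m)
    (P1 P2 : Ω → Fin m → ℝ) (hP1 : Measurable P1) (hP2 : Measurable P2)
    (hP1u : InUnit P1) (hP2u : InUnit P2)
    (h1 h2 : Fin m → Bool)
    (hsup1 : Superuniform μ P1 h1) (hsup2 : Superuniform μ P2 h2)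
    (hIndep : IndepFun P1 P2 μ)
    (hPRDS : PRDS μ P2 {j | h2 j = false})
    (S : (Fin m → ℝ) → Finset (Fin m)) (hS : MeasRule m S) (hval : ValidRule m S)
    (q1 q : ℝ) (hq1 : 0 < q1) (hq1q : q1 < q) (hq : q < 1)
    (t : ℝ) (ht0 : 0 < t) (ht : t < q1 / (1 + Hsum (m - 1)))
    (hSelThr : ∀ p : Fin m → ℝ, ∀ j ∈ S p, p j ≤ t)
    (qt : ℝ)
    (hqt : IsGreatest {x : ℝ | 0 < x ∧ x * (1 + Hsum ⌈t * m / x - 1⌉₊) = q1} qt) :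
    ∫ ω, FDP (nullNR h1 h2)
        (rejSet m S qt (fun _ => q - q1) (P1 ω) (P2 ω)) ∂μ ≤ q := by
  have hqt0 : 0 < qt := hqt.1.1
  have hqteq := hqt.1.2
  set n : ℕ := ⌈t * m / qt - 1⌉₊ with hn
  have hm0 : (0 : ℝ) < m := by exact_mod_cast hm
  have hb : 0 ≤ q - q1 := by linarith
  have htn : t ≤ (n + 1) * (qt / m) := by
    have h := Nat.le_ceil (t * m / qt - 1)
    rw [← hn, sub_le_iff_le_add, div_le_iff₀ hqt0] at h
    rw [← mul_div_assoc, le_div_iff₀ hm0]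
    exact h
  have hint : ∀ j, Integrable (fun ω =>
      weight (rejSet m S qt (fun _ => q - q1) (P1 ω) (P2 ω)) j) μ := fun j =>
    integrable_weight ((measurable_weight_rejSet hS hqt0.le hb j).comp (hP1.prodMk hP2))
  have hintS : ∀ j, Integrable (fun ω => (q - q1) * weight (S (P1 ω)) j) μ := fun j =>
    (integrable_weight ((measurable_weight_rule hS j).comp hP1)).const_mul _
  simp only [FDP_eq_sum_weight]
  rw [integral_finsetSum _ fun j _ => hint j,
    ← Finset.sum_filter_add_sum_filter_not (nullNR h1 h2) (fun j => h1 j = false)]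
  have hfirst : ∑ j ∈ (nullNR h1 h2).filter (fun j => h1 j = false),
      ∫ ω, weight (rejSet m S qt (fun _ => q - q1) (P1 ω) (P2 ω)) j ∂μ ≤ q1 := by
    calc _ ≤ ∑ j ∈ (nullNR h1 h2).filter (fun j => h1 j = false), q1 / m := by
          refine Finset.sum_le_sum fun j hj => ?_
          refine (integral_weight_primary_le hP1 hsup1 ht0.le hSelThr hqt0.le hb htn
            (Finset.mem_filter.1 hj).2).trans_eq ?_
          rw [← hqteq]
          ring
      _ ≤ m * (q1 / m) := by
          rw [Finset.sum_const, nsmul_eq_mul]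
          gcongr
          simpa using Finset.card_le_univ ((nullNR h1 h2).filter (fun j => h1 j = false))
      _ = q1 := by field_simp
  have hsecond : ∑ j ∈ (nullNR h1 h2).filter (fun j => ¬ h1 j = false),
      ∫ ω, weight (rejSet m S qt (fun _ => q - q1) (P1 ω) (P2 ω)) j ∂μ ≤ q - q1 := by
    calc _ ≤ ∑ j ∈ (nullNR h1 h2).filter (fun j => ¬ h1 j = false),
            ∫ ω, (q - q1) * weight (S (P1 ω)) j ∂μ := by
          refine Finset.sum_le_sum fun j hj => ?_
          obtain ⟨hj, hj1⟩ := Finset.mem_filter.1 hj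
          exact integral_weight_le_of_indepFun hP1 hP2 hP2u hIndep hsup2 hPRDS hS hqt0.le hb
            ((Finset.mem_filter.1 hj).2.resolve_left hj1)
      _ = ∫ ω, ∑ j ∈ (nullNR h1 h2).filter (fun j => ¬ h1 j = false),
            (q - q1) * weight (S (P1 ω)) j ∂μ :=
          (integral_finsetSum _ fun j _ => hintS j).symm
      _ ≤ ∫ _ω, (q - q1) ∂μ := by
          refine integral_mono (integrable_finsetSum _ fun j _ => hintS j) (integrable_const _)
            fun ω => ?_
          simp only [← Finset.mul_sum]
          exact mul_le_of_le_one_right hb (sum_weight_le_one _ _)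
      _ = q - q1 := by simp
  linarith

end Replicability
end

section
/- (Theorem S3.2, item 1) Suppose the random vectors P_1 and P_2 are independent, with arbitrary dependence among the coordinates within each of P_1 and P_2, and S is a valid selection rule. Consider Procedure 3.2 with parameters (q_1, q) modified as follows: in the thresholds r q_1/m and R_2 q_1/m, replace q_1 by q_1/(∑_{i=1}^m 1/i); and in the thresholds r(q−q_1)/R_1 and R_2(q−q_1)/R_1, replace q−q_1 by (q−q_1)/(∑_{i=1}^{R_1} 1/i). Then the modified procedure satisfies FDR ≤ q for the family of no-replicability nulls H_{NR,1},…,H_{NR,m}. -/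
open MeasureTheory ProbabilityTheory Finset

namespace Replicability

/-- The Benjamini–Yekutieli weight: the summation-by-parts form of `∑ k ≤ n, 1{(k-1)c < p ≤ kc} / k`,
which dominates `1{p ≤ rc} / r` simultaneously for all `1 ≤ r ≤ n`. -/
noncomputable def byWeight (n : ℕ) (c p : ℝ) : ℝ :=
  (Set.Iic (n * c)).indicator (fun _ => (n : ℝ)⁻¹) p +
    ∑ k ∈ Ico 1 n, (Set.Iic (k * c)).indicator (fun _ => (k : ℝ)⁻¹ - ((k + 1 : ℕ) : ℝ)⁻¹) p

lemma inv_sub_inv_succ_nonneg {k : ℕ} (hk : 1 ≤ k) :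
    0 ≤ (k : ℝ)⁻¹ - ((k + 1 : ℕ) : ℝ)⁻¹ := by
  have : (0 : ℝ) < k := by exact_mod_cast hk
  rw [sub_nonneg]
  gcongr
  omega

lemma byWeight_nonneg (n : ℕ) (c p : ℝ) : 0 ≤ byWeight n c p :=
  add_nonneg (Set.indicator_nonneg (fun _ _ => by positivity) _)
    (sum_nonneg fun _ hk => Set.indicator_nonneg
      (fun _ _ => inv_sub_inv_succ_nonneg (mem_Ico.1 hk).1) _)

lemma inv_eq_inv_add_sum_Ico {r n : ℕ} (hrn : r ≤ n) :
    (r : ℝ)⁻¹ = (n : ℝ)⁻¹ + ∑ k ∈ Ico r n, ((k : ℝ)⁻¹ - ((k + 1 : ℕ) : ℝ)⁻¹) := by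
  induction n, hrn using Nat.le_induction with
  | base => simp
  | succ n hn ih =>
    rw [sum_Ico_succ_top hn, ih]
    ring

lemma inv_le_byWeight {r n : ℕ} {c p : ℝ} (hc : 0 ≤ c) (hr : 1 ≤ r) (hrn : r ≤ n)
    (hp : p ≤ r * c) : (r : ℝ)⁻¹ ≤ byWeight n c p := by
  have hmem : ∀ k : ℕ, r ≤ k → p ∈ Set.Iic (k * c) := fun k hk =>
    hp.trans (by gcongr)
  rw [inv_eq_inv_add_sum_Ico hrn, byWeight, Set.indicator_of_mem (hmem n hrn)]
  gcongr
  calc ∑ k ∈ Ico r n, ((k : ℝ)⁻¹ - ((k + 1 : ℕ) : ℝ)⁻¹)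
      = ∑ k ∈ Ico r n,
          (Set.Iic (k * c)).indicator (fun _ => (k : ℝ)⁻¹ - ((k + 1 : ℕ) : ℝ)⁻¹) p :=
        sum_congr rfl fun k hk => by rw [Set.indicator_of_mem (hmem k (mem_Ico.1 hk).1)]
    _ ≤ _ := sum_le_sum_of_subset_of_nonneg (Ico_subset_Ico_left hr) fun k hk _ =>
        Set.indicator_nonneg (fun _ _ => inv_sub_inv_succ_nonneg (mem_Ico.1 hk).1) _

lemma measurable_byWeight (n : ℕ) (c : ℝ) : Measurable (byWeight n c) := by
  unfold byWeight
  exact (measurable_const.indicator measurableSet_Iic).add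
    (Finset.measurable_fun_sum _ fun _ _ => measurable_const.indicator measurableSet_Iic)

lemma Hsum_eq_one_add_sum_Ico {n : ℕ} (hn : 1 ≤ n) :
    Hsum n = 1 + ∑ k ∈ Ico 1 n, ((k + 1 : ℕ) : ℝ)⁻¹ := by
  rw [Hsum, range_eq_Ico, sum_eq_sum_Ico_succ_bot (by omega)]
  simp

lemma Hsum_pos {n : ℕ} (hn : 1 ≤ n) : 0 < Hsum n := by
  rw [Hsum_eq_one_add_sum_Ico hn]
  positivity

section Expectation

variable {Ω : Type*} [MeasurableSpace Ω] {μ : Measure Ω} [IsProbabilityMeasure μ]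

lemma integrable_indicator_Iic_comp {X : Ω → ℝ} (hX : Measurable X) (t v : ℝ) :
    Integrable (fun ω => (Set.Iic t).indicator (fun _ => v) (X ω)) μ :=
  (integrable_const v).indicator (hX measurableSet_Iic)

lemma integrable_byWeight_comp {X : Ω → ℝ} (hX : Measurable X) (n : ℕ) (c : ℝ) :
    Integrable (fun ω => byWeight n c (X ω)) μ :=
  (integrable_indicator_Iic_comp hX _ _).add
    (integrable_finsetSum _ fun _ _ => integrable_indicator_Iic_comp hX _ _)

lemma integral_indicator_Iic_comp_le {X : Ω → ℝ} (hX : Measurable X)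
    (hsup : ∀ x : ℝ, 0 ≤ x → x ≤ 1 → μ {ω | X ω ≤ x} ≤ ENNReal.ofReal x)
    {t v : ℝ} (ht : 0 ≤ t) (hv : 0 ≤ v) :
    ∫ ω, (Set.Iic t).indicator (fun _ => v) (X ω) ∂μ ≤ t * v := by
  have heq : (fun ω => (Set.Iic t).indicator (fun _ => v) (X ω)) =
      {ω | X ω ≤ t}.indicator fun _ => v := rfl
  rw [heq, integral_indicator_const v (measurableSet_le hX measurable_const), smul_eq_mul]
  gcongr
  rcases le_total t 1 with h | h
  · exact ENNReal.toReal_le_of_le_ofReal ht (hsup t ht h)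
  · exact measureReal_le_one.trans h

/-- A superuniform variable has expected Benjamini–Yekutieli weight at most `c * Hsum n`. -/
lemma integral_byWeight_comp_le {X : Ω → ℝ} (hX : Measurable X)
    (hsup : ∀ x : ℝ, 0 ≤ x → x ≤ 1 → μ {ω | X ω ≤ x} ≤ ENNReal.ofReal x)
    {n : ℕ} {c : ℝ} (hn : 1 ≤ n) (hc : 0 ≤ c) :
    ∫ ω, byWeight n c (X ω) ∂μ ≤ c * Hsum n := by
  unfold byWeight
  rw [integral_add (integrable_indicator_Iic_comp hX _ _)
      (integrable_finsetSum _ fun _ _ => integrable_indicator_Iic_comp hX _ _),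
    integral_finsetSum _ fun _ _ => integrable_indicator_Iic_comp hX _ _,
    Hsum_eq_one_add_sum_Ico hn, mul_add, mul_sum, mul_one]
  refine add_le_add ?_ (sum_le_sum fun k hk => ?_)
  · refine (integral_indicator_Iic_comp_le hX hsup (by positivity) (by positivity)).trans_eq ?_
    have : (n : ℝ) ≠ 0 := by positivity
    field_simp
  · have hk1 := (mem_Ico.1 hk).1
    refine (integral_indicator_Iic_comp_le hX hsup (by positivity)
      (inv_sub_inv_succ_nonneg hk1)).trans_eq ?_
    have : (k : ℝ) ≠ 0 := by positivity
    push_cast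
    field_simp
    ring

end Expectation

lemma FDP_nonneg {m : ℕ} (I R : Finset (Fin m)) : 0 ≤ FDP I R := by
  unfold FDP
  positivity

/-- A rejected hypothesis has both p-values below the thresholds indexed by the number of
rejections. -/
lemma le_of_mem_rejSet {m : ℕ} {S : (Fin m → ℝ) → Finset (Fin m)} {a : ℝ} {b : ℕ → ℝ}
    {p1 p2 : Fin m → ℝ} (ha : 0 ≤ a) (hb : 0 ≤ b (S p1).card) {j : Fin m}
    (hj : j ∈ rejSet m S a b p1 p2) :
    p1 j ≤ (rejSet m S a b p1 p2).card * (a / m) ∧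
      p2 j ≤ (rejSet m S a b p1 p2).card * (b (S p1).card / (S p1).card) := by
  set T : Set ℕ := {r : ℕ | r ≤ m ∧ ((S p1).filter
    (fun j => p1 j ≤ r * a / m ∧ p2 j ≤ r * b (S p1).card / (S p1).card)).card = r}
  have hR : rejSet m S a b p1 p2 = (S p1).filter (fun j => p1 j ≤ (sSup T : ℕ) * a / m ∧
    p2 j ≤ (sSup T : ℕ) * b (S p1).card / (S p1).card) := rfl
  have hcard : sSup T ≤ (rejSet m S a b p1 p2).card := by
    rcases T.eq_empty_or_nonempty with h | h
    · simp [h]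
    · rw [hR, (Nat.sSup_mem h ⟨m, fun r hr => hr.1⟩).2]
  have hcard' : ((sSup T : ℕ) : ℝ) ≤ (rejSet m S a b p1 p2).card := by exact_mod_cast hcard
  have hj' := hj
  rw [hR, mem_filter] at hj'
  obtain ⟨-, h1, h2⟩ := hj'
  rw [mul_div_assoc] at h1 h2
  exact ⟨h1.trans (by gcongr), h2.trans (by gcongr)⟩

lemma rejSet_subset {m : ℕ} {S : (Fin m → ℝ) → Finset (Fin m)} {a : ℝ} {b : ℕ → ℝ}
    {p1 p2 : Fin m → ℝ} : rejSet m S a b p1 p2 ⊆ S p1 :=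
  filter_subset _ _

/-- Pointwise domination of the false discovery proportion by a sum of primary-study weights
over the nulls of the first study and follow-up weights over the selected nulls of the second. -/
lemma FDP_rejSet_le {m : ℕ} {S : (Fin m → ℝ) → Finset (Fin m)} {a : ℝ} {b : ℕ → ℝ}
    {p1 p2 : Fin m → ℝ} (ha : 0 ≤ a) (hb : 0 ≤ b (S p1).card) (h1 h2 : Fin m → Bool) :
    FDP (nullNR h1 h2) (rejSet m S a b p1 p2) ≤
      ∑ j with h1 j = false, byWeight m (a / m) (p1 j) +
      ∑ j ∈ S p1 with h2 j = false,
        byWeight (S p1).card (b (S p1).card / (S p1).card) (p2 j) := by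
  set R := rejSet m S a b p1 p2
  set c := b (S p1).card / (S p1).card
  have hRS : R ⊆ S p1 := rejSet_subset
  have hcardS : R.card ≤ (S p1).card := card_le_card hRS
  have hcardm : R.card ≤ m := (card_le_univ R).trans_eq (Fintype.card_fin m)
  have hsub : R ∩ nullNR h1 h2 ⊆
      R.filter (fun j => h1 j = false) ∪ R.filter (fun j => h2 j = false) := by
    intro j
    simp only [nullNR, mem_inter, mem_filter, mem_union, mem_univ, true_and]
    tauto
  have hcard : ((R ∩ nullNR h1 h2).card : ℝ) ≤
      (R.filter fun j => h1 j = false).card + (R.filter fun j => h2 j = false).card := by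
    exact_mod_cast (card_le_card hsub).trans (card_union_le _ _)
  have hle : ∀ j ∈ R, (R.card : ℝ)⁻¹ ≤ byWeight m (a / m) (p1 j) ∧
      (R.card : ℝ)⁻¹ ≤ byWeight (S p1).card c (p2 j) := fun j hj =>
    ⟨inv_le_byWeight (by positivity) (card_pos.2 ⟨j, hj⟩) hcardm (le_of_mem_rejSet ha hb hj).1,
      inv_le_byWeight (by positivity) (card_pos.2 ⟨j, hj⟩) hcardS (le_of_mem_rejSet ha hb hj).2⟩
  rcases R.eq_empty_or_nonempty with h | h
  · rw [h, FDP]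
    simp only [empty_inter, card_empty, Nat.cast_zero, zero_div]
    exact add_nonneg (sum_nonneg fun _ _ => byWeight_nonneg _ _ _)
      (sum_nonneg fun _ _ => byWeight_nonneg _ _ _)
  calc FDP (nullNR h1 h2) R
      ≤ ((R.filter fun j => h1 j = false).card + (R.filter fun j => h2 j = false).card) *
          (R.card : ℝ)⁻¹ := by
        rw [FDP, max_eq_left (card_pos.2 h), div_eq_mul_inv]
        gcongr
    _ = ∑ j ∈ R with h1 j = false, (R.card : ℝ)⁻¹ + ∑ j ∈ R with h2 j = false, (R.card : ℝ)⁻¹ := by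
        simp only [sum_const, nsmul_eq_mul, add_mul]
    _ ≤ ∑ j ∈ R with h1 j = false, byWeight m (a / m) (p1 j) +
          ∑ j ∈ R with h2 j = false, byWeight (S p1).card c (p2 j) :=
        add_le_add (sum_le_sum fun j hj => (hle j (mem_filter.1 hj).1).1)
          (sum_le_sum fun j hj => (hle j (mem_filter.1 hj).1).2)
    _ ≤ _ := add_le_add
        (sum_le_sum_of_subset_of_nonneg (filter_subset_filter _ (subset_univ _))
          fun _ _ _ => byWeight_nonneg _ _ _)
        (sum_le_sum_of_subset_of_nonneg (filter_subset_filter _ hRS)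
          fun _ _ _ => byWeight_nonneg _ _ _)

section Independence

variable {Ω : Type*} [MeasurableSpace Ω] {μ : Measure Ω}
  {m : ℕ} {P1 P2 : Ω → Fin m → ℝ} {S : (Fin m → ℝ) → Finset (Fin m)}

lemma sum_indicator_selection_eq (G : Finset (Fin m) → (Fin m → ℝ) → ℝ) (p1 p2 : Fin m → ℝ) :
    ∑ A, {p | S p = A}.indicator (fun _ => (1 : ℝ)) p1 * G A p2 = G (S p1) p2 := by
  rw [sum_eq_single (S p1)]
  · simp
  · intro A _ hA
    simp [Ne.symm hA]
  · simp

lemma integrable_selection_comp (hP1 : Measurable P1) (hS : MeasRule m S)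
    {G : Finset (Fin m) → (Fin m → ℝ) → ℝ} (hG : ∀ A, Integrable (fun ω => G A (P2 ω)) μ) :
    Integrable (fun ω => G (S (P1 ω)) (P2 ω)) μ := by
  simp_rw [← sum_indicator_selection_eq (S := S) G]
  refine integrable_finsetSum _ fun A _ => ?_
  refine ((hG A).indicator (hP1 (hS A))).congr (Filter.Eventually.of_forall fun ω => ?_)
  by_cases h : S (P1 ω) = A <;> simp [h]

/-- If for each fixed selected set `A` the integral of `G A ∘ P2` is at most `C`, then so is the
integral with `A` replaced by the independent random set `S ∘ P1`. -/
lemma integral_selection_comp_le [IsProbabilityMeasure μ] (hP1 : Measurable P1)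
    (hIndep : IndepFun P1 P2 μ) (hS : MeasRule m S)
    {G : Finset (Fin m) → (Fin m → ℝ) → ℝ} (hGm : ∀ A, Measurable (G A))
    (hG : ∀ A, Integrable (fun ω => G A (P2 ω)) μ) {C : ℝ}
    (hC : ∀ A, ∫ ω, G A (P2 ω) ∂μ ≤ C) :
    ∫ ω, G (S (P1 ω)) (P2 ω) ∂μ ≤ C := by
  have hind : ∀ A, Measurable ({p | S p = A}.indicator fun _ => (1 : ℝ)) := fun A =>
    measurable_const.indicator (hS A)
  have hindi : ∀ A, Integrable (fun ω => {p | S p = A}.indicator (fun _ => (1 : ℝ)) (P1 ω)) μ :=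
    fun A => (integrable_const (1 : ℝ)).indicator (hP1 (hS A))
  have hI : ∀ A, IndepFun (fun ω => {p | S p = A}.indicator (fun _ => (1 : ℝ)) (P1 ω))
      (fun ω => G A (P2 ω)) μ := fun A => hIndep.comp (hind A) (hGm A)
  have hone : ∑ A, ∫ ω, {p | S p = A}.indicator (fun _ => (1 : ℝ)) (P1 ω) ∂μ = 1 := by
    rw [← integral_finsetSum _ fun A _ => hindi A]
    have h := fun ω => sum_indicator_selection_eq (S := S) (fun _ _ => 1) (P1 ω) (P1 ω)
    simp only [mul_one] at h
    simp [h]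
  calc ∫ ω, G (S (P1 ω)) (P2 ω) ∂μ
      = ∑ A, (∫ ω, {p | S p = A}.indicator (fun _ => (1 : ℝ)) (P1 ω) ∂μ) *
          ∫ ω, G A (P2 ω) ∂μ := by
        simp_rw [← sum_indicator_selection_eq (S := S) G]
        refine (integral_finsetSum _ fun A _ =>
          (hI A).integrable_mul (hindi A) (hG A)).trans ?_
        exact sum_congr rfl fun A _ => (hI A).integral_fun_mul_eq_mul_integral
          (hindi A).aestronglyMeasurable (hG A).aestronglyMeasurable
    _ ≤ ∑ A, (∫ ω, {p | S p = A}.indicator (fun _ => (1 : ℝ)) (P1 ω) ∂μ) * C :=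
        sum_le_sum fun A _ => mul_le_mul_of_nonneg_left (hC A)
          (integral_nonneg fun ω => Set.indicator_nonneg (fun _ _ => zero_le_one) _)
    _ = C := by rw [← sum_mul, hone, one_mul]

end Independence

/-- Summing the expected weights of the nulls in a family `A`, with the harmonic correction at
level `t`, gives at most `t`. -/
lemma integral_sum_byWeight_le {Ω : Type*} [MeasurableSpace Ω] {μ : Measure Ω}
    [IsProbabilityMeasure μ] {m : ℕ} {P : Ω → Fin m → ℝ} {h : Fin m → Bool} (hP : Measurable P)
    (hsup : Superuniform μ P h) {t : ℝ} (ht : 0 ≤ t) (A : Finset (Fin m)) :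
    ∫ ω, ∑ j ∈ A with h j = false, byWeight A.card (t / Hsum A.card / A.card) (P ω j) ∂μ ≤ t := by
  rcases A.eq_empty_or_nonempty with rfl | hA
  · simpa using ht
  have hn : 1 ≤ A.card := card_pos.2 hA
  have hH := Hsum_pos hn
  have hn' : (0 : ℝ) < A.card := by exact_mod_cast hn
  have hPj : ∀ j, Measurable fun ω => P ω j := fun j => (measurable_pi_apply j).comp hP
  rw [integral_finsetSum _ fun j _ => integrable_byWeight_comp (hPj j) _ _]
  calc ∑ j ∈ A with h j = false, ∫ ω, byWeight A.card (t / Hsum A.card / A.card) (P ω j) ∂μ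
      ≤ ∑ j ∈ A with h j = false, t / A.card := by
        refine sum_le_sum fun j hj => (integral_byWeight_comp_le
          (hPj j) (hsup j (mem_filter.1 hj).2) hn
          (by positivity)).trans_eq ?_
        field_simp
    _ ≤ ∑ j ∈ A, t / A.card :=
        sum_le_sum_of_subset_of_nonneg (filter_subset _ _) fun _ _ _ => by positivity
    _ = t := by
        rw [sum_const, nsmul_eq_mul]
        field_simp

/-- Theorem S3.2, item 1: with arbitrary dependence within each study (the
two studies independent) and a valid selection rule, Procedure 3.2 modified by replacing `q₁`
with `q₁/(∑_{i=1}^m 1/i)` in the primary thresholds and `q - q₁` with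
`(q - q₁)/(∑_{i=1}^{R₁} 1/i)` in the follow-up thresholds controls the FDR at level `q`. -/
theorem theorem_S32_item1 {Ω : Type*} [MeasurableSpace Ω]
    (μ : Measure Ω) [IsProbabilityMeasure μ]
    (m : ℕ) (hm : 1 ≤ m)
    (P1 P2 : Ω → Fin m → ℝ) (hP1 : Measurable P1) (hP2 : Measurable P2)
    (hP1u : InUnit P1) (hP2u : InUnit P2)
    (h1 h2 : Fin m → Bool)
    (hsup1 : Superuniform μ P1 h1) (hsup2 : Superuniform μ P2 h2)
    (hIndep : IndepFun P1 P2 μ)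
    (S : (Fin m → ℝ) → Finset (Fin m)) (hS : MeasRule m S) (hval : ValidRule m S)
    (q1 q : ℝ) (hq1 : 0 < q1) (hq1q : q1 < q) (hq : q < 1) :
    ∫ ω, FDP (nullNR h1 h2)
        (rejSet m S (q1 / Hsum m) (fun R1 => (q - q1) / Hsum R1) (P1 ω) (P2 ω)) ∂μ
      ≤ q := by
  have hH := Hsum_pos hm
  have ha : 0 ≤ q1 / Hsum m := by positivity
  have hd : 0 ≤ q - q1 := by linarith
  have hb : ∀ n : ℕ, 0 ≤ (q - q1) / Hsum n := fun n =>
    div_nonneg hd (sum_nonneg fun _ _ => by positivity)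
  let G : Finset (Fin m) → (Fin m → ℝ) → ℝ := fun A p =>
    ∑ j ∈ A with h2 j = false, byWeight A.card ((q - q1) / Hsum A.card / A.card) (p j)
  have hGm : ∀ A, Measurable (G A) := fun A => Finset.measurable_fun_sum _ fun j _ =>
    (measurable_byWeight _ _).comp (measurable_pi_apply j)
  have hGi : ∀ A, Integrable (fun ω => G A (P2 ω)) μ := fun A =>
    integrable_finsetSum _ fun j _ =>
      integrable_byWeight_comp ((measurable_pi_apply j).comp hP2) _ _
  have hFi : Integrable (fun ω =>
      ∑ j with h1 j = false, byWeight m (q1 / Hsum m / m) (P1 ω j)) μ :=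
    integrable_finsetSum _ fun j _ =>
      integrable_byWeight_comp ((measurable_pi_apply j).comp hP1) _ _
  have hSi := integrable_selection_comp hP1 hS hGi
  have hF : ∫ ω, ∑ j with h1 j = false, byWeight m (q1 / Hsum m / m) (P1 ω j) ∂μ ≤ q1 := by
    simpa using integral_sum_byWeight_le hP1 hsup1 hq1.le univ
  have hG : ∫ ω, G (S (P1 ω)) (P2 ω) ∂μ ≤ q - q1 :=
    integral_selection_comp_le hP1 hIndep hS hGm hGi
      fun A => integral_sum_byWeight_le hP2 hsup2 hd A
  have hle : ∀ ω, FDP (nullNR h1 h2)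
      (rejSet m S (q1 / Hsum m) (fun R1 => (q - q1) / Hsum R1) (P1 ω) (P2 ω)) ≤
        (∑ j with h1 j = false, byWeight m (q1 / Hsum m / m) (P1 ω j)) +
          G (S (P1 ω)) (P2 ω) := fun ω =>
    FDP_rejSet_le (b := fun R1 => (q - q1) / Hsum R1) ha (hb _) h1 h2
  calc _ ≤ ∫ ω, (∑ j with h1 j = false, byWeight m (q1 / Hsum m / m) (P1 ω j)) +
          G (S (P1 ω)) (P2 ω) ∂μ :=
        integral_mono_of_nonneg (Filter.Eventually.of_forall fun ω => FDP_nonneg _ _)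
          (hFi.add hSi)
          (Filter.Eventually.of_forall hle)
    _ ≤ q := by
        rw [integral_add hFi hSi]
        linarith

end Replicability
end
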